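/- arXiv:math/0312113 — 7 statements merged into one kernel-verified Lean document; each statement's English description precedes it below -/
import Mathlib

section
/- Let X and E be normed vector spaces over a nontrivially normed field 𝕜, let F be a normed 𝕜-vector space, U ⊆ X open, n ≥ 1, and let f : U × Eⁿ → F be a map such that f(x,·) : Eⁿ → F is a continuous n-linear map for each x ∈ U. Suppose there are a jointly continuous map d₁f : U × Eⁿ × X → F which is linear in its last argument, and a jointly continuous map R : U^{[1]} × Eⁿ → F with R(x,z,0,y) = 0 for all x ∈ U, z ∈ X, y ∈ Eⁿ, such that f(x + t·z, y) − f(x,y) = t·d₁f(x,y,z) + t·R(x,z,t,y) for all (x,z,t) ∈ U^{[1]} and y ∈ Eⁿ. Then the map φ : U → L^n(E,F), φ(x) := f(x,·), is continuous, where L^n(E,F) denotes the space of continuous n-linear maps Eⁿ → F equipped with the operator norm. -/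
/-- Lemma A.1 of the paper.
Let `f : U × Eⁿ → F` be such that `f(x,·)` is a continuous `n`-linear map for
each `x ∈ U`, and suppose `f` admits a first-order Taylor expansion in the
`X`-variable: `f(x + t•z, y) - f(x,y) = t•d₁f(x,y,z) + t•R(x,z,t,y)` with
`d₁f` jointly continuous and linear in `z`, and `R` jointly continuous with
`R(x,z,0,y) = 0`. Then `x ↦ f(x,·)` is continuous from `U` into the space of
continuous `n`-linear maps `Eⁿ → F` with the operator norm. -/
theorem stmt4 {𝕜 : Type*} [NontriviallyNormedField 𝕜]
    {X E F : Type*} [NormedAddCommGroup X] [NormedSpace 𝕜 X]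
    [NormedAddCommGroup E] [NormedSpace 𝕜 E]
    [NormedAddCommGroup F] [NormedSpace 𝕜 F]
    (U : Set X) (hU : IsOpen U) (n : ℕ) (hn : 1 ≤ n)
    (f : X → ContinuousMultilinearMap 𝕜 (fun _ : Fin n => E) F)
    (d₁f : X → (Fin n → E) → X → F) (R : X → X → 𝕜 → (Fin n → E) → F)
    (hd₁f_cont : ContinuousOn (fun p : X × (Fin n → E) × X => d₁f p.1 p.2.1 p.2.2)
      (U ×ˢ (Set.univ : Set ((Fin n → E) × X))))
    (hd₁f_lin : ∀ x ∈ U, ∀ y : Fin n → E, IsLinearMap 𝕜 (d₁f x y))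
    (hR_cont : ContinuousOn
      (fun p : (X × X × 𝕜) × (Fin n → E) => R p.1.1 p.1.2.1 p.1.2.2 p.2)
      (({p : X × X × 𝕜 | p.1 ∈ U ∧ p.1 + p.2.2 • p.2.1 ∈ U}) ×ˢ
        (Set.univ : Set (Fin n → E))))
    (hR_zero : ∀ x ∈ U, ∀ (z : X) (y : Fin n → E), R x z 0 y = 0)
    (hexp : ∀ x ∈ U, ∀ (z : X) (t : 𝕜), x + t • z ∈ U → ∀ y : Fin n → E,
      f (x + t • z) y - f x y = t • d₁f x y z + t • R x z t y) :
    ContinuousOn f U := by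
  rw [Metric.continuousOn_iff]
  intro x₀ hx₀ ε hε
  have hd0 : d₁f x₀ 0 0 = 0 := (hd₁f_lin x₀ hx₀ 0).map_zero
  have hR0 : R x₀ 0 0 0 = 0 := hR_zero x₀ hx₀ 0 0
  obtain ⟨r₁, hr₁, H₁⟩ := (Metric.continuousOn_iff.1 hd₁f_cont) (x₀, 0, 0)
    ⟨hx₀, Set.mem_univ _⟩ 1 one_pos
  obtain ⟨r₂, hr₂, H₂⟩ := (Metric.continuousOn_iff.1 hR_cont) ((x₀, 0, 0), 0)
    ⟨⟨hx₀, by simpa using hx₀⟩, Set.mem_univ _⟩ 1 one_pos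
  obtain ⟨r, hr, hrr₁, hrr₂⟩ : ∃ r : ℝ, 0 < r ∧ r ≤ r₁ ∧ r ≤ r₂ :=
    ⟨min r₁ r₂, lt_min hr₁ hr₂, min_le_left _ _, min_le_right _ _⟩
  obtain ⟨c, hc⟩ := NormedField.exists_one_lt_norm 𝕜
  have hc0 : 0 < ‖c‖ := one_pos.trans hc
  obtain ⟨K, hK⟩ : ∃ K : ℝ, K = (r / ‖c‖) ^ n := ⟨_, rfl⟩
  have hK0 : 0 < K := by rw [hK]; positivity
  obtain ⟨t, ht0, ht⟩ := NormedField.exists_norm_lt 𝕜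
    (show 0 < min r (ε * K / 4) from lt_min hr (by positivity))
  have htr : ‖t‖ < r := ht.trans_le (min_le_left _ _)
  have htε : ‖t‖ < ε * K / 4 := ht.trans_le (min_le_right _ _)
  have htne : t ≠ 0 := norm_pos_iff.1 ht0
  refine ⟨r * ‖t‖, by positivity, fun x hx hxx => ?_⟩
  obtain ⟨z, hz⟩ : ∃ z : X, z = t⁻¹ • (x - x₀) := ⟨_, rfl⟩
  have hxz : x₀ + t • z = x := by
    rw [hz, smul_inv_smul₀ htne]; abel
  have hzr : ‖z‖ < r := by
    rw [hz, norm_smul, norm_inv, inv_mul_lt_iff₀ ht0, mul_comm, ← dist_eq_norm]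
    exact hxx
  have key : ∀ y : Fin n → E, ‖y‖ < r → ‖(f x - f x₀) y‖ ≤ 2 * ‖t‖ := by
    intro y hy
    have h1 := H₁ (x₀, y, z) ⟨hx₀, Set.mem_univ _⟩ (by
      simp only [Prod.dist_eq, dist_self, dist_zero_right]
      exact max_lt hr₁ (max_lt (hy.trans_le hrr₁) (hzr.trans_le hrr₁)))
    have h2 := H₂ ((x₀, z, t), y) ⟨⟨hx₀, by simpa [hxz] using hx⟩, Set.mem_univ _⟩ (by
      simp only [Prod.dist_eq, dist_self, dist_zero_right]
      exact max_lt (max_lt hr₂ (max_lt (hzr.trans_le hrr₂) (htr.trans_le hrr₂)))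
        (hy.trans_le hrr₂))
    simp only [hd0, hR0, dist_zero_right] at h1 h2
    have h3 := hexp x₀ hx₀ z t (by rw [hxz]; exact hx) y
    rw [hxz] at h3
    rw [sub_apply, h3, ← smul_add, norm_smul, mul_comm]
    have h4 := norm_add_le (d₁f x₀ y z) (R x₀ z t y)
    exact mul_le_mul_of_nonneg_right (by linarith) ht0.le
  have hb : ‖f x - f x₀‖ ≤ 2 * ‖t‖ / K := by
    refine ContinuousMultilinearMap.opNorm_le_bound (by positivity) ?_
    refine MultilinearMap.bound_of_shell (f x - f x₀).toMultilinearMap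
      (ε := fun _ => r) (c := fun _ => c) (fun _ => hr) (fun _ => hc) ?_
    intro m hm1 hm2
    have hKm : K ≤ ∏ i, ‖m i‖ := by
      have := Finset.prod_le_prod (s := Finset.univ) (f := fun _ : Fin n => r / ‖c‖)
        (g := fun i => ‖m i‖) (fun _ _ => by positivity) (fun i _ => hm1 i)
      simpa [hK, div_pow] using this
    refine (key m ((pi_norm_lt_iff hr).2 hm2)).trans ?_
    calc 2 * ‖t‖ = 2 * ‖t‖ / K * K := by field_simp
      _ ≤ _ := by gcongr
  rw [dist_eq_norm]
  refine hb.trans_lt ?_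
  rw [div_lt_iff₀ hK0]
  have : 0 < ε * K := by positivity
  linarith
end

section
/- Let E be a normed vector space over a nontrivially normed field whose norm is ultrametric, let r ∈ (0,1] and α ∈ (0,1], and suppose E carries a ball group structure of radius r such that ‖x*y − x − y‖ ≤ α·‖x‖·‖y‖ for all x,y ∈ B_r(0) and ‖x⁻¹ + x‖ ≤ α·‖x‖² for all x ∈ B_r(0), where x⁻¹ denotes the inverse of x in the group (B_r(0),*). Then ‖xⁿ − n·x‖ ≤ α·‖x‖² for every x ∈ B_r(0) and every integer n, where xⁿ is the n-th power in (B_r(0),*) and n·x is the n-th additive multiple of x in E. -/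
/-- A *ball group structure of radius `r`* on a seminormed group `E`: a group
multiplication `mul` on the open ball `B_r(0)` with identity element `0` and
inversion `inv`, such that for every `s ∈ (0, r]` the ball `B_s(0)` is a
subgroup of `(B_r(0), mul)`. The operations are recorded as total maps on `E`;
all axioms are only required on the relevant balls. -/
structure BallGroupStructure (E : Type*) [SeminormedAddCommGroup E] (r : ℝ) where
  /-- the group multiplication `*` on `B_r(0)` -/
  mul : E → E → E
  /-- the group inversion on `B_r(0)` -/
  inv : E → E
  /-- each ball `B_s(0)` with `0 < s ≤ r` is closed under multiplication -/
  mul_mem : ∀ s : ℝ, 0 < s → s ≤ r → ∀ x y : E, ‖x‖ < s → ‖y‖ < s → ‖mul x y‖ < s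
  /-- each ball `B_s(0)` with `0 < s ≤ r` is closed under inversion -/
  inv_mem : ∀ s : ℝ, 0 < s → s ≤ r → ∀ x : E, ‖x‖ < s → ‖inv x‖ < s
  /-- associativity on `B_r(0)` -/
  mul_assoc : ∀ x y z : E, ‖x‖ < r → ‖y‖ < r → ‖z‖ < r →
    mul (mul x y) z = mul x (mul y z)
  /-- `0` is a right identity -/
  mul_zero : ∀ x : E, ‖x‖ < r → mul x 0 = x
  /-- `0` is a left identity -/
  zero_mul : ∀ x : E, ‖x‖ < r → mul 0 x = x
  /-- `inv` is a right inverse -/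
  mul_inv : ∀ x : E, ‖x‖ < r → mul x (inv x) = 0
  /-- `inv` is a left inverse -/
  inv_mul : ∀ x : E, ‖x‖ < r → mul (inv x) x = 0

/-- `n`-th power (`n : ℕ`) of `x` in the group `(B_r(0), *)`. -/
def BallGroupStructure.pow {E : Type*} [SeminormedAddCommGroup E] {r : ℝ}
    (S : BallGroupStructure E r) (x : E) : ℕ → E
  | 0 => 0
  | n + 1 => S.mul (S.pow x n) x

/-- `n`-th power (`n : ℤ`) of `x` in the group `(B_r(0), *)`. -/
def BallGroupStructure.zpow {E : Type*} [SeminormedAddCommGroup E] {r : ℝ}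
    (S : BallGroupStructure E r) (x : E) : ℤ → E
  | Int.ofNat n => S.pow x n
  | Int.negSucc n => S.inv (S.pow x (n + 1))

theorem stmt6_pow_aux {E : Type*} [NormedAddCommGroup E] [IsUltrametricDist E]
    {r α : ℝ} (hr1 : r ≤ 1) (hα0 : 0 < α) (hα1 : α ≤ 1)
    (S : BallGroupStructure E r)
    (hmul : ∀ x y : E, ‖x‖ < r → ‖y‖ < r → ‖S.mul x y - x - y‖ ≤ α * ‖x‖ * ‖y‖)
    (x : E) (hx : ‖x‖ < r) (n : ℕ) :
    ‖n • x‖ ≤ ‖x‖ ∧ ‖S.pow x n‖ ≤ ‖x‖ ∧ ‖S.pow x n - n • x‖ ≤ α * ‖x‖ ^ 2 := by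
  have h0 := norm_nonneg x
  have hsmall : α * ‖x‖ ^ 2 ≤ ‖x‖ := by
    have h1 : α * ‖x‖ ≤ 1 := mul_le_one₀ hα1 h0 (by linarith)
    nlinarith
  induction n with
  | zero =>
    have : 0 ≤ α * ‖x‖ ^ 2 := by positivity
    simp [BallGroupStructure.pow, this]
  | succ n ih =>
    obtain ⟨h1, h2, h3⟩ := ih
    have a1 : ‖(n + 1) • x‖ ≤ ‖x‖ := by
      rw [succ_nsmul]
      exact (IsUltrametricDist.norm_add_le_max _ _).trans (max_le h1 le_rfl)
    have a3 : ‖S.pow x (n + 1) - (n + 1) • x‖ ≤ α * ‖x‖ ^ 2 := by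
      have e : S.pow x (n + 1) - (n + 1) • x =
          (S.mul (S.pow x n) x - S.pow x n - x) + (S.pow x n - n • x) := by
        rw [succ_nsmul, BallGroupStructure.pow]; abel
      rw [e]
      refine (IsUltrametricDist.norm_add_le_max _ _).trans (max_le ?_ h3)
      refine (hmul _ _ (h2.trans_lt hx) hx).trans ?_
      rw [pow_two, ← mul_assoc]
      gcongr
    refine ⟨a1, ?_, a3⟩
    have e : S.pow x (n + 1) = (S.pow x (n + 1) - (n + 1) • x) + (n + 1) • x := by abel
    rw [e]
    exact (IsUltrametricDist.norm_add_le_max _ _).trans (max_le (a3.trans hsmall) a1)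

/-- Proposition 2.1(l) of the paper.
For a ball group structure of radius `r ∈ (0,1]` on an ultrametric normed
vector space `E`, satisfying `‖x*y - x - y‖ ≤ α‖x‖‖y‖` and
`‖x⁻¹ + x‖ ≤ α‖x‖²` on `B_r(0)` for some `α ∈ (0,1]`, one has
`‖xⁿ - n·x‖ ≤ α‖x‖²` for every `x ∈ B_r(0)` and every integer `n`. -/
theorem stmt6 {𝕜 : Type*} [NontriviallyNormedField 𝕜]
    {E : Type*} [NormedAddCommGroup E] [NormedSpace 𝕜 E] [IsUltrametricDist E]
    {r α : ℝ} (hr0 : 0 < r) (hr1 : r ≤ 1) (hα0 : 0 < α) (hα1 : α ≤ 1)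
    (S : BallGroupStructure E r)
    (hmul : ∀ x y : E, ‖x‖ < r → ‖y‖ < r → ‖S.mul x y - x - y‖ ≤ α * ‖x‖ * ‖y‖)
    (hinv : ∀ x : E, ‖x‖ < r → ‖S.inv x + x‖ ≤ α * ‖x‖ ^ 2)
    (x : E) (hx : ‖x‖ < r) (n : ℤ) :
    ‖S.zpow x n - n • x‖ ≤ α * ‖x‖ ^ 2 := by
  cases n with
  | ofNat n =>
    have h := (stmt6_pow_aux hr1 hα0 hα1 S hmul x hx n).2.2
    simpa [BallGroupStructure.zpow] using h
  | negSucc n =>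
    obtain ⟨-, h2, h3⟩ := stmt6_pow_aux hr1 hα0 hα1 S hmul x hx (n + 1)
    have e : S.zpow x (Int.negSucc n) - (Int.negSucc n) • x =
        (S.inv (S.pow x (n + 1)) + S.pow x (n + 1)) - (S.pow x (n + 1) - (n + 1) • x) := by
      rw [negSucc_zsmul, BallGroupStructure.zpow]; abel
    rw [e, sub_eq_add_neg]
    refine (IsUltrametricDist.norm_add_le_max _ _).trans (max_le ?_ (by rwa [norm_neg]))
    refine (hinv _ (h2.trans_lt hx)).trans ?_
    gcongr
end

section
/- Let 𝕜 be a nontrivially normed field whose norm is ultrametric, let p be a prime with ‖(p : 𝕜)‖ = 1/p, and let E be a normed 𝕜-vector space whose norm is ultrametric. Let r ∈ (0,1] and α > 0 with α·r ≤ 1/p, and suppose E carries a ball group structure of radius r such that ‖x*y − x − y‖ ≤ α·‖x‖·‖y‖ for all x,y ∈ B_r(0) and ‖x⁻¹ + x‖ ≤ α·‖x‖² for all x ∈ B_r(0). Then for every x ∈ B_r(0) and every n ∈ ℕ one has ‖x^{pⁿ}‖ = p^{−n}·‖x‖, where x^{pⁿ} is the pⁿ-th power of x in the group (B_r(0),*).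 -/
theorem BGS_umax {E : Type*} [SeminormedAddCommGroup E] [IsUltrametricDist E] {c : ℝ} {a b : E}
    (ha : ‖a‖ ≤ c) (hb : ‖b‖ ≤ c) : ‖a + b‖ ≤ c :=
  (IsUltrametricDist.norm_add_le_max a b).trans (max_le ha hb)

theorem BGS_pow_bounds {E : Type*} [NormedAddCommGroup E] [IsUltrametricDist E]
    {r α : ℝ} (hα0 : 0 < α) (hαr : α * r ≤ 1)
    (S : BallGroupStructure E r)
    (hmul : ∀ x y : E, ‖x‖ < r → ‖y‖ < r → ‖S.mul x y - x - y‖ ≤ α * ‖x‖ * ‖y‖)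
    (x : E) (hx : ‖x‖ < r) (k : ℕ) :
    ‖S.pow x k‖ ≤ ‖x‖ ∧ ‖S.pow x k - k • x‖ ≤ α * ‖x‖ * ‖x‖ := by
  induction k with
  | zero => simp only [BallGroupStructure.pow]; simp; positivity
  | succ k ih =>
    obtain ⟨h1, h2⟩ := ih
    have h3 := hmul (S.pow x k) x (h1.trans_lt hx) hx
    have h4 : α * ‖S.pow x k‖ * ‖x‖ ≤ α * ‖x‖ * ‖x‖ := by gcongr
    have h5 : α * ‖x‖ * ‖x‖ ≤ ‖x‖ := by
      have : α * ‖x‖ ≤ 1 := le_trans (by gcongr) hαr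
      nlinarith [norm_nonneg x]
    simp only [BallGroupStructure.pow]
    constructor
    · have e : S.mul (S.pow x k) x = (S.mul (S.pow x k) x - S.pow x k - x) + (S.pow x k + x) := by
        abel
      rw [e]
      exact BGS_umax (h3.trans (h4.trans h5)) (BGS_umax h1 le_rfl)
    · have e : S.mul (S.pow x k) x - (k + 1) • x
          = (S.mul (S.pow x k) x - S.pow x k - x) + (S.pow x k - k • x) := by
        rw [add_smul, one_smul]; abel
      rw [e]
      exact BGS_umax (h3.trans h4) h2

theorem BGS_pow_mem {E : Type*} [NormedAddCommGroup E] {r : ℝ} (hr0 : 0 < r)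
    (S : BallGroupStructure E r) (x : E) (hx : ‖x‖ < r) (k : ℕ) : ‖S.pow x k‖ < r := by
  induction k with
  | zero => simpa [BallGroupStructure.pow] using hr0
  | succ k ih => exact S.mul_mem r hr0 le_rfl _ _ ih hx

theorem BGS_pow_add {E : Type*} [NormedAddCommGroup E] {r : ℝ} (hr0 : 0 < r)
    (S : BallGroupStructure E r) (x : E) (hx : ‖x‖ < r) (m k : ℕ) :
    S.pow x (m + k) = S.mul (S.pow x m) (S.pow x k) := by
  have hm := BGS_pow_mem hr0 S x hx
  induction k with
  | zero => exact (S.mul_zero _ (hm m)).symm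
  | succ k ih =>
    have : S.pow x (m + (k + 1)) = S.mul (S.pow x (m + k)) x := rfl
    rw [this, ih, S.mul_assoc _ _ _ (hm m) (hm k) hx]
    rfl

theorem BGS_pow_mul {E : Type*} [NormedAddCommGroup E] {r : ℝ} (hr0 : 0 < r)
    (S : BallGroupStructure E r) (x : E) (hx : ‖x‖ < r) (m k : ℕ) :
    S.pow x (m * k) = S.pow (S.pow x m) k := by
  induction k with
  | zero => rfl
  | succ k ih =>
    rw [Nat.mul_succ, BGS_pow_add hr0 S x hx, ih]
    rfl

/-- characteristic-zero case of Proposition 2.1(i) of the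
paper. Let `𝕜` be an ultrametric nontrivially normed field with
`‖(p : 𝕜)‖ = 1/p` for a prime `p`, and let `E` be an ultrametric normed
`𝕜`-vector space with a ball group structure of radius `r ∈ (0,1]` satisfying
`‖x*y - x - y‖ ≤ α‖x‖‖y‖` and `‖x⁻¹ + x‖ ≤ α‖x‖²`, where `α > 0` and
`α·r ≤ 1/p`. Then `‖x^{pⁿ}‖ = p⁻ⁿ‖x‖` for all `x ∈ B_r(0)` and `n : ℕ`. -/
theorem stmt8 {𝕜 : Type*} [NontriviallyNormedField 𝕜] [IsUltrametricDist 𝕜]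
    {E : Type*} [NormedAddCommGroup E] [NormedSpace 𝕜 E] [IsUltrametricDist E]
    (p : ℕ) (hp : p.Prime) (hpnorm : ‖(p : 𝕜)‖ = 1 / p)
    {r α : ℝ} (hr0 : 0 < r) (hr1 : r ≤ 1) (hα0 : 0 < α) (hαr : α * r ≤ 1 / p)
    (S : BallGroupStructure E r)
    (hmul : ∀ x y : E, ‖x‖ < r → ‖y‖ < r → ‖S.mul x y - x - y‖ ≤ α * ‖x‖ * ‖y‖)
    (hinv : ∀ x : E, ‖x‖ < r → ‖S.inv x + x‖ ≤ α * ‖x‖ ^ 2)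
    (x : E) (hx : ‖x‖ < r) (n : ℕ) :
    ‖S.pow x (p ^ n)‖ = ((p : ℝ) ^ n)⁻¹ * ‖x‖ := by
  have hp1 : (1 : ℝ) ≤ p := by exact_mod_cast hp.one_lt.le
  have hp0 : (0 : ℝ) < p := by linarith
  have hαr1 : α * r ≤ 1 := hαr.trans (by rw [div_le_one hp0]; exact hp1)
  have key : ∀ y : E, ‖y‖ < r → ‖S.pow y p‖ = (p : ℝ)⁻¹ * ‖y‖ := by
    intro y hy
    obtain ⟨h1, h2⟩ := BGS_pow_bounds hα0 hαr1 S hmul y hy p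
    rcases eq_or_ne y 0 with rfl | hy0
    · simpa using h1
    have hpos : 0 < ‖y‖ := norm_pos_iff.mpr hy0
    have hn : ‖p • y‖ = (p : ℝ)⁻¹ * ‖y‖ := by
      rw [← Nat.cast_smul_eq_nsmul 𝕜, norm_smul, hpnorm, one_div]
    have hlt : ‖S.pow y p - p • y‖ < ‖p • y‖ := by
      refine h2.trans_lt ?_
      rw [hn]
      refine mul_lt_mul_of_pos_right ?_ hpos
      rw [← one_div]
      exact (mul_lt_mul_of_pos_left hy hα0).trans_le hαr
    have e : S.pow y p = (S.pow y p - p • y) + p • y := by abel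
    rw [e, IsUltrametricDist.norm_add_eq_max_of_norm_ne_norm hlt.ne, max_eq_right hlt.le, hn]
  induction n with
  | zero =>
    have : S.pow x 1 = x := S.zero_mul x hx
    simp [this]
  | succ n ih =>
    rw [pow_succ p n, BGS_pow_mul hr0 S x hx, key _ (BGS_pow_mem hr0 S x hx _), ih, pow_succ,
      mul_inv]
    ring
end

section
/- Let 𝕜 be a nontrivially normed field whose norm is ultrametric, let p be a prime with ‖(p : 𝕜)‖ = 1/p, and let E be a complete normed 𝕜-vector space whose norm is ultrametric. Let r ∈ (0,1] and α > 0 with α·r ≤ 1/p, and suppose E carries a ball group structure of radius r such that ‖x*y − x − y‖ ≤ α·‖x‖·‖y‖ for all x,y ∈ B_r(0) and ‖x⁻¹ + x‖ ≤ α·‖x‖² for all x ∈ B_r(0). Then the sequence of maps Fₙ : B_r(0) → E, Fₙ(x) := (p : 𝕜)^{−n}·(x^{pⁿ}) (where x^{pⁿ} is the pⁿ-th power in the group (B_r(0),*) and the scalar acts on E), converges uniformly on B_r(0) to a map L : B_r(0) → E, and this limit satisfies ‖L(x)‖ = ‖x‖ for every x ∈ B_r(0). -/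
open Filter

section helpers

variable {𝕜 : Type*} [NontriviallyNormedField 𝕜] [IsUltrametricDist 𝕜]
    {E : Type*} [NormedAddCommGroup E] [NormedSpace 𝕜 E] [IsUltrametricDist E]

lemma bgs_norm_pow_lt {r : ℝ} (S : BallGroupStructure E r) (hr0 : 0 < r) {x : E}
    (hx : ‖x‖ < r) (n : ℕ) : ‖S.pow x n‖ < r := by
  induction n with
  | zero => simpa [BallGroupStructure.pow] using hr0
  | succ n ih => exact S.mul_mem r hr0 le_rfl _ _ ih hx

lemma bgs_pow_add {r : ℝ} (S : BallGroupStructure E r) (hr0 : 0 < r) {x : E}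
    (hx : ‖x‖ < r) (m n : ℕ) : S.pow x (m + n) = S.mul (S.pow x m) (S.pow x n) := by
  induction n with
  | zero => exact (S.mul_zero _ (bgs_norm_pow_lt S hr0 hx m)).symm
  | succ n ih =>
    change S.mul (S.pow x (m + n)) x = S.mul (S.pow x m) (S.mul (S.pow x n) x)
    rw [ih, S.mul_assoc _ _ _ (bgs_norm_pow_lt S hr0 hx m) (bgs_norm_pow_lt S hr0 hx n) hx]

lemma bgs_pow_mul {r : ℝ} (S : BallGroupStructure E r) (hr0 : 0 < r) {x : E}
    (hx : ‖x‖ < r) (m n : ℕ) : S.pow x (m * n) = S.pow (S.pow x m) n := by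
  induction n with
  | zero => rfl
  | succ n ih =>
    rw [Nat.mul_succ, bgs_pow_add S hr0 hx, ih]
    rfl

lemma bgs_norm_pow_le {r : ℝ} (S : BallGroupStructure E r) {x : E}
    (hx : ‖x‖ < r) (n : ℕ) : ‖S.pow x n‖ ≤ ‖x‖ := by
  refine le_of_forall_gt_imp_ge_of_dense fun s hs => ?_
  have hx0 := norm_nonneg x
  have hm : 0 < min s r := lt_min (hx0.trans_lt hs) (hx0.trans_lt hx)
  have key : ‖S.pow x n‖ < min s r := by
    induction n with
    | zero => simpa [BallGroupStructure.pow] using hm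
    | succ n ih => exact S.mul_mem _ hm (min_le_right _ _) _ _ ih (lt_min hs hx)
  exact key.le.trans (min_le_left _ _)

lemma bgs_pow_sub {r α : ℝ} (hα0 : 0 < α) (S : BallGroupStructure E r)
    (hmul : ∀ x y : E, ‖x‖ < r → ‖y‖ < r → ‖S.mul x y - x - y‖ ≤ α * ‖x‖ * ‖y‖)
    {x : E} (hx : ‖x‖ < r) (n : ℕ) : ‖S.pow x n - n • x‖ ≤ α * ‖x‖ * ‖x‖ := by
  induction n with
  | zero => simp only [BallGroupStructure.pow, zero_smul, sub_zero, norm_zero]; positivity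
  | succ n ih =>
    have hle := bgs_norm_pow_le S hx n
    have h1 := hmul (S.pow x n) x (hle.trans_lt hx) hx
    have h2 : α * ‖S.pow x n‖ * ‖x‖ ≤ α * ‖x‖ * ‖x‖ := by gcongr
    have e : S.pow x (n + 1) - (n + 1) • x =
        (S.mul (S.pow x n) x - S.pow x n - x) + (S.pow x n - n • x) := by
      rw [add_smul, one_smul]
      change S.mul (S.pow x n) x - _ = _
      abel
    rw [e]
    exact (IsUltrametricDist.norm_add_le_max _ _).trans (max_le (h1.trans h2) ih)

end helpers

/-- core of Proposition 3.3(o) of the paper.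
In the setting of an ultrametric nontrivially normed field `𝕜` with
`‖(p : 𝕜)‖ = 1/p`, and a *complete* ultrametric normed `𝕜`-vector space `E`
with a ball group structure of radius `r ∈ (0,1]` satisfying
`‖x*y - x - y‖ ≤ α‖x‖‖y‖` and `‖x⁻¹ + x‖ ≤ α‖x‖²` (`α > 0`, `α·r ≤ 1/p`),
the maps `x ↦ p⁻ⁿ • x^{pⁿ}` converge uniformly on `B_r(0)` to a map `L`
satisfying `‖L(x)‖ = ‖x‖` for all `x ∈ B_r(0)`. -/
theorem stmt9 {𝕜 : Type*} [NontriviallyNormedField 𝕜] [IsUltrametricDist 𝕜]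
    {E : Type*} [NormedAddCommGroup E] [NormedSpace 𝕜 E] [IsUltrametricDist E]
    [CompleteSpace E]
    (p : ℕ) (hp : p.Prime) (hpnorm : ‖(p : 𝕜)‖ = 1 / p)
    {r α : ℝ} (hr0 : 0 < r) (hr1 : r ≤ 1) (hα0 : 0 < α) (hαr : α * r ≤ 1 / p)
    (S : BallGroupStructure E r)
    (hmul : ∀ x y : E, ‖x‖ < r → ‖y‖ < r → ‖S.mul x y - x - y‖ ≤ α * ‖x‖ * ‖y‖)
    (hinv : ∀ x : E, ‖x‖ < r → ‖S.inv x + x‖ ≤ α * ‖x‖ ^ 2) :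
    ∃ L : E → E,
      TendstoUniformlyOn (fun (n : ℕ) (x : E) => ((p : 𝕜) ^ n)⁻¹ • S.pow x (p ^ n))
        L atTop (Metric.ball (0 : E) r) ∧
      ∀ x : E, ‖x‖ < r → ‖L x‖ = ‖x‖ := by
  have hp1 : (1 : ℝ) < p := by exact_mod_cast hp.one_lt
  have hp0 : (0 : ℝ) < p := by linarith
  have hpk : (p : 𝕜) ≠ 0 := by
    rw [← norm_pos_iff, hpnorm]; positivity
  have hsub : ∀ x : E, ‖x‖ < r → ‖S.pow x p - (p : 𝕜) • x‖ ≤ α * ‖x‖ * ‖x‖ := by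
    intro x hx
    have := bgs_pow_sub hα0 S hmul hx p
    rwa [← Nat.cast_smul_eq_nsmul 𝕜 p x] at this
  have hnp : ∀ x : E, ‖x‖ < r → ‖S.pow x p‖ = 1 / p * ‖x‖ := by
    intro x hx
    have hle := hsub x hx
    rcases eq_or_ne x 0 with rfl | hx0
    · simpa using hle
    have hxp : 0 < ‖x‖ := norm_pos_iff.mpr hx0
    have hs : ‖(p : 𝕜) • x‖ = 1 / p * ‖x‖ := by rw [norm_smul, hpnorm]
    have hlt : ‖S.pow x p - (p : 𝕜) • x‖ < ‖(p : 𝕜) • x‖ := by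
      rw [hs]
      refine hle.trans_lt ?_
      have : α * ‖x‖ < 1 / p := lt_of_lt_of_le (by gcongr) hαr
      gcongr
    have h := IsUltrametricDist.norm_add_eq_max_of_norm_ne_norm hlt.ne
    rw [sub_add_cancel, max_eq_right hlt.le] at h
    rw [h, hs]
  have hpow : ∀ x : E, ‖x‖ < r → ∀ n : ℕ, S.pow x (p ^ (n + 1)) = S.pow (S.pow x (p ^ n)) p := by
    intro x hx n
    rw [pow_succ, bgs_pow_mul S hr0 hx]
  have hnn : ∀ x : E, ‖x‖ < r → ∀ n : ℕ, ‖S.pow x (p ^ n)‖ = (1 / p) ^ n * ‖x‖ := by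
    intro x hx n
    induction n with
    | zero =>
      have : S.pow x 1 = x := S.zero_mul x hx
      simp [this]
    | succ n ih =>
      rw [hpow x hx, hnp _ (bgs_norm_pow_lt S hr0 hx _), ih]
      ring
  set F : ℕ → E → E := fun n x => ((p : 𝕜) ^ n)⁻¹ • S.pow x (p ^ n) with hF
  have hFn : ∀ x : E, ‖x‖ < r → ∀ n, ‖F n x‖ = ‖x‖ := by
    intro x hx n
    simp only [hF]
    rw [norm_smul, norm_inv, norm_pow, hpnorm, hnn x hx, inv_mul_cancel_left₀]
    positivity
  have hd : ∀ x : E, ‖x‖ < r → ∀ n, dist (F n x) (F (n + 1) x) ≤ r * (1 / p) ^ n := by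
    intro x hx n
    have hy := bgs_norm_pow_lt S hr0 hx (p ^ n)
    have e : F (n + 1) x - F n x = ((p : 𝕜) ^ (n + 1))⁻¹ •
        (S.pow (S.pow x (p ^ n)) p - (p : 𝕜) • S.pow x (p ^ n)) := by
      simp only [hF]
      rw [hpow x hx, smul_sub, smul_smul]
      congr 2
      field_simp
      ring
    rw [dist_comm, dist_eq_norm, e, norm_smul, norm_inv, norm_pow, hpnorm]
    have h := hsub _ hy
    rw [hnn x hx] at h
    have hq : (0 : ℝ) < 1 / p := by positivity
    generalize (1 / p : ℝ) = q at *
    rw [inv_mul_le_iff₀ (by positivity)]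
    refine h.trans ?_
    have h1 : α * ‖x‖ ≤ q := le_trans (by gcongr) hαr
    calc α * (q ^ n * ‖x‖) * (q ^ n * ‖x‖) = q ^ n * q ^ n * ((α * ‖x‖) * ‖x‖) := by ring
      _ ≤ q ^ n * q ^ n * (q * r) := by gcongr
      _ = q ^ (n + 1) * (r * q ^ n) := by ring
  have hq1 : (1 / p : ℝ) < 1 := by rw [div_lt_one hp0]; exact hp1
  have hex : ∀ x : E, ∃ l : E, ‖x‖ < r → Tendsto (fun n => F n x) atTop (nhds l) := by
    intro x
    by_cases hx : ‖x‖ < r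
    · obtain ⟨l, hl⟩ := cauchySeq_tendsto_of_complete
        (cauchySeq_of_le_geometric _ _ hq1 (hd x hx))
      exact ⟨l, fun _ => hl⟩
    · exact ⟨0, fun h => absurd h hx⟩
  choose L hL using hex
  refine ⟨L, ?_, ?_⟩
  · rw [Metric.tendstoUniformlyOn_iff]
    intro ε hε
    have ht : Tendsto (fun n : ℕ => r * (1 / p : ℝ) ^ n / (1 - 1 / p)) atTop (nhds 0) := by
      have := ((tendsto_pow_atTop_nhds_zero_of_lt_one (by positivity) hq1).const_mul r).div_const
        (1 - 1 / p : ℝ)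
      simpa using this
    filter_upwards [ht.eventually_lt_const hε] with n hn x hx
    have hx' : ‖x‖ < r := by simpa using hx
    rw [dist_comm]
    exact (dist_le_of_le_geometric_of_tendsto _ _ hq1 (hd x hx') (hL x hx') n).trans_lt hn
  · intro x hx
    refine tendsto_nhds_unique (hL x hx).norm ?_
    simp only [hFn x hx]
    exact tendsto_const_nhds
end

section
/- Let E be a normed vector space over the field ℚ_p of p-adic numbers whose norm is ultrametric, let r ∈ (0,1] and α ∈ (0,1], and suppose E carries a ball group structure of radius r such that ‖x*y − x − y‖ ≤ α·‖x‖·‖y‖ for all x,y ∈ B_r(0) and ‖x⁻¹ + x‖ ≤ α·‖x‖² for all x ∈ B_r(0). Fix x ∈ B_r(0) and let η : ℤ_p → B_r(0) be a continuous map with η(n) = xⁿ for every n ∈ ℤ (powers taken in the group (B_r(0),*)). Then ‖η(z) − z·x‖ ≤ α·‖x‖² for every z ∈ ℤ_p, where z·x denotes scalar multiplication in E by z ∈ ℤ_p ⊆ ℚ_p. -/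
/-- Proposition 3.3(n) of the paper.
Let `E` be an ultrametric normed vector space over `ℚ_p` with a ball group
structure of radius `r ∈ (0,1]` satisfying `‖x*y - x - y‖ ≤ α‖x‖‖y‖` and
`‖x⁻¹ + x‖ ≤ α‖x‖²` for some `α ∈ (0,1]`. If `x ∈ B_r(0)` and
`η : ℤ_p → B_r(0)` is a continuous map with `η(n) = xⁿ` for all `n ∈ ℤ`
(powers in the group `(B_r(0), *)`), then `‖η(z) - z•x‖ ≤ α‖x‖²` for all
`z ∈ ℤ_p`. -/
theorem stmt10 (p : ℕ) [hp : Fact p.Prime]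
    {E : Type*} [NormedAddCommGroup E] [NormedSpace ℚ_[p] E] [IsUltrametricDist E]
    {r α : ℝ} (hr0 : 0 < r) (hr1 : r ≤ 1) (hα0 : 0 < α) (hα1 : α ≤ 1)
    (S : BallGroupStructure E r)
    (hmul : ∀ x y : E, ‖x‖ < r → ‖y‖ < r → ‖S.mul x y - x - y‖ ≤ α * ‖x‖ * ‖y‖)
    (hinv : ∀ x : E, ‖x‖ < r → ‖S.inv x + x‖ ≤ α * ‖x‖ ^ 2)
    (x : E) (hx : ‖x‖ < r)
    (η : ℤ_[p] → E) (hηcont : Continuous η)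
    (hηball : ∀ z : ℤ_[p], ‖η z‖ < r)
    (hηpow : ∀ n : ℤ, η (n : ℤ_[p]) = S.zpow x n)
    (z : ℤ_[p]) :
    ‖η z - (z : ℚ_[p]) • x‖ ≤ α * ‖x‖ ^ 2 := by
  have key : ∀ n : ℕ, ‖S.pow x n - (n : ℚ_[p]) • x‖ ≤ α * ‖x‖ ^ 2 := by
    intro n
    induction n with
    | zero =>
      simp only [BallGroupStructure.pow, Nat.cast_zero, zero_smul, sub_zero, norm_zero]
      positivity
    | succ n ih =>
      have hn0 := norm_nonneg x
      have hnx : ‖(n : ℚ_[p]) • x‖ ≤ ‖x‖ := by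
        rw [norm_smul]
        have h1 : ‖(n : ℚ_[p])‖ ≤ 1 := by
          have := PadicInt.norm_le_one (n : ℤ_[p])
          rwa [PadicInt.norm_def, PadicInt.coe_natCast] at this
        nlinarith
      have hsq : α * ‖x‖ ^ 2 ≤ ‖x‖ := by
        have h1 : ‖x‖ ^ 2 ≤ ‖x‖ := by nlinarith
        nlinarith [sq_nonneg ‖x‖]
      have hpow : ‖S.pow x n‖ ≤ ‖x‖ := by
        have h := IsUltrametricDist.norm_add_le_max (S.pow x n - (n : ℚ_[p]) • x)
          ((n : ℚ_[p]) • x)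
        rw [sub_add_cancel] at h
        exact h.trans (max_le (ih.trans hsq) hnx)
      have hm := hmul (S.pow x n) x (hpow.trans_lt hx) hx
      have hm2 : α * ‖S.pow x n‖ * ‖x‖ ≤ α * ‖x‖ ^ 2 := by
        rw [pow_two, ← mul_assoc]
        gcongr
      have h := IsUltrametricDist.norm_add_le_max (S.mul (S.pow x n) x - S.pow x n - x)
        (S.pow x n - (n : ℚ_[p]) • x)
      have e : S.pow x (n + 1) - ((n + 1 : ℕ) : ℚ_[p]) • x =
          (S.mul (S.pow x n) x - S.pow x n - x) + (S.pow x n - (n : ℚ_[p]) • x) := by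
        simp only [BallGroupStructure.pow, Nat.cast_add, Nat.cast_one, add_smul, one_smul]
        abel
      rw [e]
      exact h.trans (max_le (hm.trans hm2) ih)
  refine PadicInt.denseRange_natCast.induction_on
    (p := fun z : ℤ_[p] => ‖η z - (z : ℚ_[p]) • x‖ ≤ α * ‖x‖ ^ 2) z ?_ ?_
  · have hc : Continuous (fun z : ℤ_[p] => (z : ℚ_[p])) := continuous_subtype_val
    exact isClosed_le ((hηcont.sub (hc.smul continuous_const)).norm) continuous_const
  · intro n
    have h := hηpow n
    rw [Int.cast_natCast] at h
    rw [h, PadicInt.coe_natCast]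
    exact key n
end

section
/- Let 𝕜 be a complete nontrivially normed field whose norm is ultrametric, let E be a complete normed 𝕜-vector space whose norm is ultrametric, let r > 0, B := {v ∈ E : ‖v‖ < r}, and let c ∈ 𝕜 with 0 < ‖c‖ < 1. Let τ : E → E satisfy τ(0) = 0 and ‖τ(v) − τ(w)‖ = ‖c‖·‖v − w‖ for all v,w ∈ B (so τ maps B into B). Let T : E → L(E) be continuous on B with T(0) = c·id_E and ‖c⁻¹·T(x) − id_E‖ < 1 for every x ∈ B, and assume that at every x ∈ B the map τ has T(x) as its strict Fréchet derivative. Finally, let f : E → E be a map such that for every x ∈ B the limit f(x) = lim_{n→∞} c^{−n}·τⁿ(x) exists (τⁿ being the n-fold iterate of τ). Then for every x ∈ B the operators Aₙ(x) := c^{−n}·( T(τ^{n−1}(x)) ∘ T(τ^{n−2}(x)) ∘ ⋯ ∘ T(x) ) converge in the operator norm of L(E) to an operator A(x), and f has A(x) as its strict Fréchet derivative at x. -/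
open Filter

/-- The normalized chain-rule product: `chainOps T τ x n = T(τ^{n-1}x) ∘ ⋯ ∘ T(x)`
(and the identity for `n = 0`). -/
noncomputable def chainOps {𝕜 E : Type*} [NontriviallyNormedField 𝕜]
    [NormedAddCommGroup E] [NormedSpace 𝕜 E]
    (T : E → E →L[𝕜] E) (τ : E → E) (x : E) : ℕ → (E →L[𝕜] E)
  | 0 => ContinuousLinearMap.id 𝕜 E
  | n + 1 => (T (τ^[n] x)).comp (chainOps T τ x n)

theorem ultra_telescope {E : Type*} [NormedAddCommGroup E] [IsUltrametricDist E]
    (u : ℕ → E) (C : ℝ) (hC : 0 ≤ C) (N : ℕ) (h : ∀ n, N ≤ n → ‖u (n + 1) - u n‖ ≤ C) :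
    ∀ n, N ≤ n → ‖u n - u N‖ ≤ C := by
  intro n hn
  induction n, hn using Nat.le_induction with
  | base => simpa using hC
  | succ n hn ih =>
    have : u (n + 1) - u N = (u (n + 1) - u n) + (u n - u N) := by abel
    rw [this]
    exact (IsUltrametricDist.norm_add_le_max _ _).trans (max_le (h n hn) ih)

/-- analytic core of Proposition 3.3(q) of the paper.
Let `𝕜` be a complete ultrametric nontrivially normed field, `E` a complete
ultrametric normed `𝕜`-space, `B = B_r(0)` and `c ∈ 𝕜` with `0 < ‖c‖ < 1`.
Let `τ : E → E` with `τ(0) = 0` and `‖τ v - τ w‖ = ‖c‖‖v - w‖` on `B`, and let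
`T : E → L(E)` be continuous on `B` with `T(0) = c·id`,
`‖c⁻¹·T(x) - id‖ < 1` on `B`, such that `τ` has strict Fréchet derivative
`T(x)` at every `x ∈ B`. If `f(x) = lim_n c⁻ⁿ·τⁿ(x)` exists for all `x ∈ B`,
then at every `x ∈ B` the operators `Aₙ(x) = c⁻ⁿ·(T(τ^{n-1}x) ∘ ⋯ ∘ T(x))`
converge in operator norm to some `A(x)`, and `f` has strict Fréchet
derivative `A(x)` at `x`. -/
theorem stmt12 {𝕜 : Type*} [NontriviallyNormedField 𝕜] [CompleteSpace 𝕜]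
    [IsUltrametricDist 𝕜]
    {E : Type*} [NormedAddCommGroup E] [NormedSpace 𝕜 E] [CompleteSpace E]
    [IsUltrametricDist E]
    (r : ℝ) (hr : 0 < r) (c : 𝕜) (hc0 : 0 < ‖c‖) (hc1 : ‖c‖ < 1)
    (τ : E → E) (hτ0 : τ 0 = 0)
    (hτiso : ∀ v ∈ Metric.ball (0 : E) r, ∀ w ∈ Metric.ball (0 : E) r,
      ‖τ v - τ w‖ = ‖c‖ * ‖v - w‖)
    (T : E → E →L[𝕜] E) (hTcont : ContinuousOn T (Metric.ball (0 : E) r))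
    (hT0 : T 0 = c • ContinuousLinearMap.id 𝕜 E)
    (hTnear : ∀ x ∈ Metric.ball (0 : E) r,
      ‖c⁻¹ • T x - ContinuousLinearMap.id 𝕜 E‖ < 1)
    (hτderiv : ∀ x ∈ Metric.ball (0 : E) r, HasStrictFDerivAt τ (T x) x)
    (f : E → E)
    (hf : ∀ x ∈ Metric.ball (0 : E) r,
      Tendsto (fun n : ℕ => (c ^ n)⁻¹ • τ^[n] x) atTop (nhds (f x))) :
    ∀ x ∈ Metric.ball (0 : E) r, ∃ A : E →L[𝕜] E,
      Tendsto (fun n : ℕ => (c ^ n)⁻¹ • chainOps T τ x n) atTop (nhds A) ∧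
      HasStrictFDerivAt f A x := by
  have hc : c ≠ 0 := norm_pos_iff.1 hc0
  have h0 : (0 : E) ∈ Metric.ball (0 : E) r := Metric.mem_ball_self hr
  have hmaps : ∀ v ∈ Metric.ball (0 : E) r, τ v ∈ Metric.ball (0 : E) r := by
    intro v hv
    have h1 := hτiso v hv 0 h0
    rw [hτ0, sub_zero, sub_zero] at h1
    rw [mem_ball_zero_iff] at hv ⊢
    rw [h1]
    nlinarith [norm_nonneg v]
  have hit : ∀ n : ℕ, ∀ v ∈ Metric.ball (0 : E) r, τ^[n] v ∈ Metric.ball (0 : E) r := by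
    intro n
    induction n with
    | zero => intro v hv; simpa using hv
    | succ n ih =>
      intro v hv
      rw [Function.iterate_succ_apply']
      exact hmaps _ (ih v hv)
  have hitiso : ∀ n : ℕ, ∀ v ∈ Metric.ball (0 : E) r, ∀ w ∈ Metric.ball (0 : E) r,
      ‖τ^[n] v - τ^[n] w‖ = ‖c‖ ^ n * ‖v - w‖ := by
    intro n v hv w hw
    induction n with
    | zero => simp
    | succ n ih =>
      rw [Function.iterate_succ_apply', Function.iterate_succ_apply',
        hτiso _ (hit n v hv) _ (hit n w hw), ih, pow_succ]
      ring
  have hit0 : ∀ n : ℕ, τ^[n] 0 = 0 := fun n => Function.iterate_fixed hτ0 n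
  have hitnorm : ∀ n : ℕ, ∀ v ∈ Metric.ball (0 : E) r, ‖τ^[n] v‖ ≤ ‖c‖ ^ n * r := by
    intro n v hv
    have h1 := hitiso n v hv 0 h0
    rw [hit0, sub_zero, sub_zero] at h1
    rw [h1]
    rw [mem_ball_zero_iff] at hv
    gcongr
  have hpow : Tendsto (fun n : ℕ => ‖c‖ ^ n * r) atTop (nhds 0) := by
    simpa using (tendsto_pow_atTop_nhds_zero_of_lt_one hc0.le hc1).mul_const r
  -- uniform closeness near zero of the normalized maps
  have hsmall : ∀ ε : ℝ, 0 < ε → ∃ N : ℕ, ∀ n, N ≤ n →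
      ∀ v ∈ Metric.ball (0 : E) r, ∀ w ∈ Metric.ball (0 : E) r,
      ‖((c ^ (n + 1))⁻¹ • τ^[n + 1] w - (c ^ (n + 1))⁻¹ • τ^[n + 1] v)
        - ((c ^ n)⁻¹ • τ^[n] w - (c ^ n)⁻¹ • τ^[n] v)‖ ≤ ε * ‖w - v‖ := by
    intro ε hε
    have hd := (hτderiv 0 h0).isLittleO.def (mul_pos hε hc0)
    rw [Metric.eventually_nhds_iff] at hd
    obtain ⟨δ, hδ, hd⟩ := hd
    obtain ⟨N, hN⟩ := eventually_atTop.1 (hpow.eventually (gt_mem_nhds hδ))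
    refine ⟨N, fun n hn v hv w hw => ?_⟩
    have hv' := (hitnorm n v hv).trans_lt (hN n hn)
    have hw' := (hitnorm n w hw).trans_lt (hN n hn)
    have h1 := @hd (τ^[n] w, τ^[n] v) (by
      rw [Prod.dist_eq]
      simpa [dist_zero_right] using And.intro hw' hv')
    simp only [hT0, ContinuousLinearMap.smul_apply, ContinuousLinearMap.id_apply] at h1
    rw [hitiso n w hw v hv] at h1
    have h2 : ((c ^ (n + 1))⁻¹ • τ^[n + 1] w - (c ^ (n + 1))⁻¹ • τ^[n + 1] v)
        - ((c ^ n)⁻¹ • τ^[n] w - (c ^ n)⁻¹ • τ^[n] v) =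
        (c ^ (n + 1))⁻¹ • (τ (τ^[n] w) - τ (τ^[n] v) - c • (τ^[n] w - τ^[n] v)) := by
      have : (c ^ n)⁻¹ = (c ^ (n + 1))⁻¹ * c := by field_simp; ring
      rw [Function.iterate_succ_apply', Function.iterate_succ_apply', this,
        mul_smul, mul_smul]
      module
    rw [h2, norm_smul, norm_inv, norm_pow]
    calc (‖c‖ ^ (n + 1))⁻¹ * _ ≤ (‖c‖ ^ (n + 1))⁻¹ * (ε * ‖c‖ * (‖c‖ ^ n * ‖w - v‖)) := by
          gcongr
      _ = ε * ‖w - v‖ := by field_simp; ring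
  intro x hx
  set B : ℕ → E →L[𝕜] E := fun n => (c ^ n)⁻¹ • chainOps T τ x n with hB
  have hBsucc : ∀ n v, B (n + 1) v = (c⁻¹ • T (τ^[n] x)) (B n v) := by
    intro n v
    simp only [hB, chainOps, ContinuousLinearMap.smul_apply, ContinuousLinearMap.comp_apply,
      map_smul, smul_smul]
    rw [pow_succ, mul_inv, mul_comm]
  have hBdiff : ∀ n v, B (n + 1) v - B n v =
      (c⁻¹ • T (τ^[n] x) - ContinuousLinearMap.id 𝕜 E) (B n v) := by
    intro n v
    rw [hBsucc]; simp
  have hBle : ∀ n v, ‖B n v‖ ≤ ‖v‖ := by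
    intro n v
    induction n with
    | zero => simp [hB, chainOps]
    | succ n ih =>
      have h1 : B (n + 1) v = (B (n + 1) v - B n v) + B n v := by abel
      rw [h1]
      refine (IsUltrametricDist.norm_add_le_max _ _).trans (max_le ?_ ih)
      rw [hBdiff]
      refine (ContinuousLinearMap.le_opNorm _ _).trans ?_
      have := hTnear _ (hit n x hx)
      nlinarith [norm_nonneg (B n v)]
  have hTlim : Tendsto (fun n => ‖c⁻¹ • T (τ^[n] x) - ContinuousLinearMap.id 𝕜 E‖)
      atTop (nhds 0) := by
    have h1 : Tendsto (fun n => τ^[n] x) atTop (nhds 0) :=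
      squeeze_zero_norm (fun n => hitnorm n x hx) hpow
    have h2 : ContinuousAt T 0 := hTcont.continuousAt (Metric.ball_mem_nhds _ hr)
    have h3 := (((h2.tendsto.comp h1).const_smul c⁻¹).sub_const
      (ContinuousLinearMap.id 𝕜 E)).norm
    rw [hT0, smul_smul, inv_mul_cancel₀ hc, one_smul, sub_self, norm_zero] at h3
    exact h3
  have hBc : ∀ ε : ℝ, 0 < ε → ∃ N : ℕ, ∀ m, N ≤ m → ∀ n, m ≤ n → ‖B n - B m‖ ≤ ε := by
    intro ε hε
    obtain ⟨N, hN⟩ := eventually_atTop.1 (hTlim.eventually (gt_mem_nhds hε))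
    refine ⟨N, fun m hm n hn => ContinuousLinearMap.opNorm_le_bound _ hε.le fun v => ?_⟩
    refine ultra_telescope (fun n => B n v) (ε * ‖v‖) (by positivity) m (fun k hk => ?_) n hn
    simp only [hBdiff]
    refine (ContinuousLinearMap.le_opNorm _ _).trans ?_
    exact mul_le_mul (hN k (hm.trans hk)).le (hBle k v) (norm_nonneg _) hε.le
  have hcau : CauchySeq B := by
    rw [Metric.cauchySeq_iff']
    intro ε hε
    obtain ⟨N, hN⟩ := hBc (ε / 2) (by positivity)
    refine ⟨N, fun n hn => ?_⟩
    rw [dist_eq_norm]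
    linarith [hN N le_rfl n hn]
  obtain ⟨A, hA⟩ := cauchySeq_tendsto_of_complete hcau
  refine ⟨A, hA, ?_⟩
  have hch : ∀ n : ℕ, HasStrictFDerivAt (τ^[n]) (chainOps T τ x n) x := by
    intro n
    induction n with
    | zero => exact hasStrictFDerivAt_id x
    | succ n ih =>
      rw [Function.iterate_succ']
      exact (hτderiv _ (hit n x hx)).comp x ih
  refine .of_isLittleO (Asymptotics.isLittleO_iff.2 fun ε hε => ?_)
  obtain ⟨N₁, hN₁⟩ := hsmall (ε / 3) (by positivity)
  obtain ⟨N₂, hN₂⟩ := hBc (ε / 3) (by positivity)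
  set N := max N₁ N₂
  have hAB : ‖A - B N‖ ≤ ε / 3 :=
    le_of_tendsto (hA.sub_const (B N)).norm
      (eventually_atTop.2 ⟨N, fun n hn => hN₂ N (le_max_right _ _) n hn⟩)
  have hd := ((hch N).const_smul ((c ^ N)⁻¹)).isLittleO.def (show 0 < ε / 3 by positivity)
  have hball : ∀ᶠ p : E × E in nhds (x, x),
      p.1 ∈ Metric.ball (0 : E) r ∧ p.2 ∈ Metric.ball (0 : E) r :=
    (Metric.isOpen_ball.prod Metric.isOpen_ball).mem_nhds ⟨hx, hx⟩
  filter_upwards [hd, hball] with p h1 hp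
  obtain ⟨w, v⟩ := p
  obtain ⟨hw, hv⟩ := hp
  simp only at h1 hw hv ⊢
  have h2 : ‖(f w - f v) - ((c ^ N)⁻¹ • τ^[N] w - (c ^ N)⁻¹ • τ^[N] v)‖ ≤ ε / 3 * ‖w - v‖ := by
    refine le_of_tendsto (((hf w hw).sub (hf v hv)).sub_const _).norm
      (eventually_atTop.2 ⟨N, fun n hn => ?_⟩)
    exact ultra_telescope (fun n => (c ^ n)⁻¹ • τ^[n] w - (c ^ n)⁻¹ • τ^[n] v)
      (ε / 3 * ‖w - v‖) (by positivity) N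
      (fun k hk => hN₁ k ((le_max_left _ _).trans hk) v hv w hw) n hn
  have h3 : ‖(A - B N) (w - v)‖ ≤ ε / 3 * ‖w - v‖ :=
    (ContinuousLinearMap.le_opNorm _ _).trans (by gcongr)
  have h4 : f w - f v - A (w - v) =
      ((f w - f v) - ((c ^ N)⁻¹ • τ^[N] w - (c ^ N)⁻¹ • τ^[N] v))
      + ((c ^ N)⁻¹ • τ^[N] w - (c ^ N)⁻¹ • τ^[N] v - (B N) (w - v)) - (A - B N) (w - v) := by
    rw [ContinuousLinearMap.sub_apply]; abel
  have h5 : ‖(c ^ N)⁻¹ • τ^[N] w - (c ^ N)⁻¹ • τ^[N] v - (B N) (w - v)‖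
      ≤ ε / 3 * ‖w - v‖ := h1
  rw [h4]
  refine (norm_sub_le _ _).trans ?_
  have h6 := norm_add_le ((f w - f v) - ((c ^ N)⁻¹ • τ^[N] w - (c ^ N)⁻¹ • τ^[N] v))
    ((c ^ N)⁻¹ • τ^[N] w - (c ^ N)⁻¹ • τ^[N] v - (B N) (w - v))
  linarith
end

section
/- Let 𝕜 be a complete nontrivially normed field and let G be a group carrying the structure of a C¹ Lie group over 𝕜 (a charted space modelled on a normed 𝕜-vector space via a model with corners I, such that multiplication and inversion are C¹ maps). Let P ⊆ 𝕜 be an open additive subgroup and let ξ : P → G be a continuous map satisfying ξ(a+b) = ξ(a)·ξ(b) for all a,b ∈ P. Suppose that the function z ↦ φ(ξ(z)) is differentiable at 0, where φ is the preferred chart of G around the identity (the extended chart extChartAt at 1 ∈ G, which sends 1 to a point of the model space). Then ξ is C¹ on P, i.e., ξ is ContMDiffOn of order 1 as a map from the open set P ⊆ 𝕜 to G. -/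
/-- Lemma 3.2 of the paper.
Let `G` be a `C¹` Lie group over a complete nontrivially normed field `𝕜`
(a charted space modelled on a normed `𝕜`-vector space via a model with
corners `I`, with `C¹` multiplication and inversion). Let `P` be an open
additive subgroup of `𝕜` and `ξ : P → G` a continuous homomorphism. If
`z ↦ φ(ξ(z))` is differentiable at `0`, where `φ = extChartAt I 1` is the
preferred chart of `G` around the identity, then `ξ` is `C¹` on `P`. -/
theorem stmt14 {𝕜 : Type*} [NontriviallyNormedField 𝕜] [CompleteSpace 𝕜]
    {E : Type*} [NormedAddCommGroup E] [NormedSpace 𝕜 E]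
    {HM : Type*} [TopologicalSpace HM] (I : ModelWithCorners 𝕜 E HM)
    {G : Type*} [Group G] [TopologicalSpace G] [ChartedSpace HM G]
    (hGmul : ContMDiff (I.prod I) I 1 (fun q : G × G => q.1 * q.2))
    (hGinv : ContMDiff I I 1 (fun g : G => g⁻¹))
    (P : AddSubgroup 𝕜) (hP : IsOpen (P : Set 𝕜))
    (ξ : 𝕜 → G) (hξcont : ContinuousOn ξ (P : Set 𝕜))
    (hξhom : ∀ a ∈ P, ∀ b ∈ P, ξ (a + b) = ξ a * ξ b)
    (hdiff : DifferentiableAt 𝕜 (fun z : 𝕜 => extChartAt I (1 : G) (ξ z)) 0) :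
    ContMDiffOn (modelWithCornersSelf 𝕜 𝕜) I 1 ξ (P : Set 𝕜) := by
  have h0P : (0 : 𝕜) ∈ P := P.zero_mem
  have hξ0 : ξ 0 = 1 := by
    have h := hξhom 0 h0P 0 h0P
    rw [add_zero] at h
    exact (mul_eq_left.mp h.symm)
  have hPn : (P : Set 𝕜) ∈ nhds (0 : 𝕜) := hP.mem_nhds h0P
  have hc0 : ContinuousAt ξ 0 := hξcont.continuousAt hPn
  -- main step: `ξ` is `C¹` at `0`
  have key : ContMDiffAt (modelWithCornersSelf 𝕜 𝕜) I 1 ξ 0 := by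
    rw [contMDiffAt_iff]
    refine ⟨hc0, ?_⟩
    have hm := (contMDiffAt_iff.1 (hGmul.contMDiffAt (x := ((1 : G), (1 : G))))).2
    simp only [hξ0, mul_one, extChartAt_prod, PartialEquiv.prod_coe,
      ModelWithCorners.range_prod] at hm ⊢
    set φ := extChartAt I (1 : G) with hφ
    set M : E × E → E := fun q => φ (φ.symm q.1 * φ.symm q.2) with hM
    have hm2 : ContDiffWithinAt 𝕜 1 M (Set.range I ×ˢ Set.range I) (φ 1, φ 1) := hm
    have hgoal : ContDiffAt 𝕜 1 (fun z => φ (ξ z)) 0 := by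
      set F : 𝕜 → E := fun z => φ (ξ z) with hF
      have hFR : ∀ z, F z ∈ Set.range I := fun z => by simp [hF, hφ]
      have hF0 : F 0 = φ 1 := by simp [hF, hξ0]
      have hsrc : IsOpen φ.source := isOpen_extChartAt_source 1
      have h1s : (1 : G) ∈ φ.source := mem_extChartAt_source 1
      have hbase : (φ 1, φ 1) ∈ Set.range I ×ˢ Set.range I :=
        ⟨hF0 ▸ hFR 0, hF0 ▸ hFR 0⟩
      obtain ⟨u, hu, -, M', hM', hM'c⟩ :=
        (contDiffWithinAt_succ_iff_hasFDerivWithinAt (n := 0) (by simp)).1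
          (by simpa using hm2)
      rw [Set.insert_eq_of_mem hbase] at hu
      obtain ⟨w, hw, hwc⟩ := contDiffWithinAt_zero (mem_of_mem_nhdsWithin hbase hu) |>.1 hM'c
      have hv : u ∩ w ∈ nhdsWithin (φ 1, φ 1) (Set.range I ×ˢ Set.range I) := by
        refine Filter.inter_mem hu ?_
        exact (nhdsWithin_le_of_mem hu) hw
      obtain ⟨O, hO, hOm, hOs⟩ := mem_nhdsWithin.1 hv
      have hFc0 : ContinuousAt F 0 := hdiff.continuousAt
      have hsn : ∀ᶠ t in nhds (0 : 𝕜), ξ t ∈ φ.source :=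
        hc0.eventually (hsrc.mem_nhds (by rw [hξ0]; exact h1s))
      have hφc : ContinuousOn φ φ.source := continuousOn_extChartAt 1
      rw [contDiffAt_one_iff]
      refine ⟨fun s => (M' (F s, φ 1)).comp ((ContinuousLinearMap.inr 𝕜 E E).comp
        (fderiv 𝕜 F 0)), {s | s ∈ P ∧ ξ s ∈ φ.source ∧ (F s, φ 1) ∈ O}, ?_, ?_, ?_⟩
      · have h3 : ∀ᶠ s in nhds (0 : 𝕜), (F s, φ 1) ∈ O := by
          have : ContinuousAt (fun s => (F s, φ 1)) 0 := hFc0.prodMk continuousAt_const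
          exact this.eventually (hO.mem_nhds (by simpa [hF0] using hOm))
        filter_upwards [hPn, hsn, h3] with s h1 h2 h3 using ⟨h1, h2, h3⟩
      · have hFc : ContinuousOn F {s | s ∈ P ∧ ξ s ∈ φ.source ∧ (F s, φ 1) ∈ O} :=
          hφc.comp (hξcont.mono fun s hs => hs.1) (fun s hs => hs.2.1)
        refine ContinuousOn.clm_comp ?_ continuousOn_const
        refine hwc.comp (hFc.prodMk continuousOn_const) ?_
        intro s hs
        exact hOs ⟨hs.2.2, hFR s, hbase.1⟩
      · rintro s ⟨hsP, hss, hsO⟩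
        have hd : HasFDerivWithinAt M (M' (F s, φ 1)) (O ∩ (Set.range I ×ˢ Set.range I))
            (F s, φ 1) :=
          (hM' _ (hOs ⟨hsO, hFR s, hbase.1⟩).1).mono (fun q hq => (hOs hq).1)
        have hF1 : HasFDerivAt (fun y => F (y - s)) (fderiv 𝕜 F 0) s := by
          have h : HasFDerivAt F (fderiv 𝕜 F 0) (s - s) := by
            rw [sub_self]; exact hdiff.hasFDerivAt
          exact HasFDerivAt.comp (g := F) (f := fun y => y - s) s h ((hasFDerivAt_id s).sub_const s)
        have hp : HasFDerivAt (fun y => (F s, F (y - s)))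
            ((ContinuousLinearMap.inr 𝕜 E E).comp (fderiv 𝕜 F 0)) s := by
          have h := (hasFDerivAt_const (F s) s).prodMk hF1
          have he : (ContinuousLinearMap.inr 𝕜 E E).comp (fderiv 𝕜 F 0) =
              ContinuousLinearMap.prod 0 (fderiv 𝕜 F 0) := by
            ext <;> simp
          rw [he]
          exact h
        have hev : ∀ᶠ y in nhds s, (F s, F (y - s)) ∈ O := by
          refine hp.continuousAt.eventually (hO.mem_nhds ?_)
          simpa [hF0] using hsO
        have hsub : Filter.Tendsto (fun y => y - s) (nhds s) (nhds 0) := by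
          have : ContinuousAt (fun y => y - s) s := by fun_prop
          simpa [ContinuousAt] using this
        have hcomp : HasFDerivAt (fun y => M (F s, F (y - s))) ((M' (F s, φ 1)).comp
            ((ContinuousLinearMap.inr 𝕜 E E).comp (fderiv 𝕜 F 0))) s := by
          have hd2 : HasFDerivWithinAt M (M' (F s, φ 1)) (O ∩ (Set.range I ×ˢ Set.range I))
            (F s, F (s - s)) := by simpa [hF0] using hd
          have hmaps : Set.MapsTo (fun y => (F s, F (y - s))) {y | (F s, F (y - s)) ∈ O}
              (O ∩ (Set.range I ×ˢ Set.range I)) := fun y hy => ⟨hy, hFR _, hFR _⟩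
          have := HasFDerivWithinAt.comp (g := M) (f := fun y => (F s, F (y - s))) s hd2
            hp.hasFDerivWithinAt hmaps
          exact this.hasFDerivAt hev
        refine hcomp.congr_of_eventuallyEq ?_
        filter_upwards [hsub.eventually hsn, hsub.eventually hPn] with y hy1 hy2
        simp only [hM, hF]
        rw [φ.left_inv hss, φ.left_inv hy1, ← hξhom s hsP _ hy2, add_sub_cancel]
    simpa [Function.comp_def, chartAt_self_eq] using hgoal.contDiffWithinAt
  intro x hx
  apply ContMDiffAt.contMDiffWithinAt
  have hsubP : ∀ᶠ y in nhds x, y - x ∈ P := by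
    have : ContinuousAt (fun y => y - x) x := by fun_prop
    exact this.eventually (hP.mem_nhds (by simp [h0P]))
  have hsm : ContMDiffAt (modelWithCornersSelf 𝕜 𝕜) I 1 (fun y => ξ (y - x)) x := by
    have h1 : ContMDiffAt (modelWithCornersSelf 𝕜 𝕜) (modelWithCornersSelf 𝕜 𝕜) 1
        (fun y : 𝕜 => y - x) x := by
      apply ContDiffAt.contMDiffAt
      fun_prop
    exact ContMDiffAt.comp x (g := ξ) (by simpa using key) h1
  have hmul : ContMDiffAt (modelWithCornersSelf 𝕜 𝕜) I 1 (fun y => ξ x * ξ (y - x)) x :=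
    ContMDiffAt.comp x (g := fun q : G × G => q.1 * q.2)
      (f := fun y => (ξ x, ξ (y - x))) hGmul.contMDiffAt (contMDiffAt_const.prodMk hsm)
  refine hmul.congr_of_eventuallyEq ?_
  filter_upwards [hsubP] with y hy
  rw [← hξhom x hx _ hy, add_sub_cancel]
end
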